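/- arXiv:2101.06647 — 2 statements merged into one kernel-verified Lean document; each statement's English description precedes it below -/
import Mathlib

section
/- Let u be a nonzero element of O_C[[T,T⁻¹⟩[1/p], written u = Σ_{n∈ℤ} c_n Tⁿ with c_n ∈ C. Then u is a unit of O_C[[T,T⁻¹⟩[1/p] if and only if the infimum inf_{n∈ℤ} v_p(c_n) is attained, i.e. there exists n₀ ∈ ℤ with v_p(c_{n₀}) ≤ v_p(c_n) for all n ∈ ℤ. -/
/-!
Statement 4: `C` is an algebraically closed field, complete for a valuation `v_p`
with `v_p(p) = 1` and `v_p(C^×) = ℚ` (encoded via the norm `‖x‖ = p^{-v_p(x)}`).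
An element `u = ∑_{n ∈ ℤ} cₙ Tⁿ` of `O_C[[T,T⁻¹⟩[1/p]` — concretely, a
coefficient sequence `c : ℤ → C` with `inf v_p(cₙ) > -∞` (norms bounded) and
`v_p(cₙ) → ∞` as `n → -∞` (norms tend to 0 at `-∞`), multiplication being the
convolution product — is a unit if and only if `inf_n v_p(cₙ)` is attained.
-/

open Filter Topology

/-- A coefficient sequence of an element of `O_C[[T,T⁻¹⟩[1/p]`:
`inf v_p(cₙ) > -∞` and `v_p(cₙ) → ∞` as `n → -∞`. -/
def IsLaurentCoeff {C : Type*} [NormedField C] (c : ℤ → C) : Prop :=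
  (∃ M : ℝ, ∀ n, ‖c n‖ ≤ M) ∧ Tendsto (fun n : ℤ => ‖c n‖) atBot (𝓝 0)

/-- The convolution product of coefficient sequences (the multiplication of
`O_C[[T,T⁻¹⟩[1/p]`). -/
noncomputable def lconv {C : Type*} [NormedField C] (u v : ℤ → C) : ℤ → C :=
  fun n => ∑' i : ℤ, u i * v (n - i)

/-- The coefficient sequence of `1`. -/
def lone {C : Type*} [NormedField C] : ℤ → C :=
  fun n => if n = 0 then 1 else 0

section LaurentAux

variable {C : Type*} [NontriviallyNormedField C]

theorem IsLaurentCoeff.bound {u : ℤ → C} (hu : IsLaurentCoeff u) :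
    ∃ M : ℝ, 0 < M ∧ ∀ n, ‖u n‖ ≤ M := by
  obtain ⟨M, hM⟩ := hu.1
  exact ⟨max M 1, by positivity, fun n => (hM n).trans (le_max_left _ _)⟩

theorem IsLaurentCoeff.small {u : ℤ → C} (hu : IsLaurentCoeff u) {ε : ℝ} (hε : 0 < ε) :
    ∃ N : ℤ, ∀ n, n < N → ‖u n‖ < ε := by
  have h := hu.2.eventually (gt_mem_nhds hε)
  obtain ⟨N, hN⟩ := eventually_atBot.1 h
  exact ⟨N, fun n hn => hN n hn.le⟩

theorem isLaurentCoeff_of {u : ℤ → C} (M : ℝ) (hM : ∀ n, ‖u n‖ ≤ M)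
    (h : ∀ ε : ℝ, 0 < ε → ∃ N : ℤ, ∀ n, n < N → ‖u n‖ ≤ ε) : IsLaurentCoeff u := by
  refine ⟨⟨M, hM⟩, ?_⟩
  rw [Metric.tendsto_nhds]
  intro ε hε
  obtain ⟨N, hN⟩ := h (ε / 2) (by positivity)
  filter_upwards [eventually_lt_atBot N] with n hn
  rw [dist_zero_right, norm_norm]
  have := hN n hn
  linarith

theorem summable_of_finite_big [CompleteSpace C] [IsUltrametricDist C] {ι : Type*} {f : ι → C}
    (h : ∀ ε : ℝ, 0 < ε → {i | ε ≤ ‖f i‖}.Finite) : Summable f := by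
  apply NonarchimedeanAddGroup.summable_of_tendsto_cofinite_zero
  rw [Metric.tendsto_nhds]
  intro ε hε
  rw [eventually_cofinite]
  refine (h ε hε).subset ?_
  intro i hi
  simpa using hi

theorem lconv_summable [CompleteSpace C] [IsUltrametricDist C] {u v : ℤ → C}
    (hu : IsLaurentCoeff u) (hv : IsLaurentCoeff v) (n : ℤ) :
    Summable (fun i => u i * v (n - i)) := by
  apply summable_of_finite_big
  intro ε hε
  obtain ⟨A, hA, hA'⟩ := hu.bound
  obtain ⟨B, hB, hB'⟩ := hv.bound
  obtain ⟨N, hN⟩ := hu.small (ε := ε / B) (by positivity)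
  obtain ⟨K, hK⟩ := hv.small (ε := ε / A) (by positivity)
  refine (Set.finite_Icc N (n - K)).subset ?_
  intro i hi
  simp only [Set.mem_ofPred_eq, norm_mul] at hi
  constructor
  · by_contra! h
    have h1 := (lt_div_iff₀ hB).1 (hN i h)
    have h2 := mul_le_mul_of_nonneg_left (hB' (n - i)) (norm_nonneg (u i))
    linarith
  · by_contra! h
    have h1 := (lt_div_iff₀ hA).1 (hK (n - i) (by lia))
    have h2 := mul_le_mul_of_nonneg_right (hA' i) (norm_nonneg (v (n - i)))
    linarith

theorem lconv_norm_le [IsUltrametricDist C] {u v : ℤ → C} {A B : ℝ}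
    (hu : ∀ n, ‖u n‖ ≤ A) (hv : ∀ n, ‖v n‖ ≤ B) (n : ℤ) : ‖lconv u v n‖ ≤ A * B := by
  have hA : 0 ≤ A := (norm_nonneg _).trans (hu 0)
  have hB : 0 ≤ B := (norm_nonneg _).trans (hv 0)
  apply IsUltrametricDist.norm_tsum_le_of_forall_le_of_nonneg (by positivity)
  intro i
  rw [norm_mul]
  exact mul_le_mul (hu i) (hv _) (norm_nonneg _) hA

theorem lconv_isLaurent [IsUltrametricDist C] {u v : ℤ → C}
    (hu : IsLaurentCoeff u) (hv : IsLaurentCoeff v) : IsLaurentCoeff (lconv u v) := by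
  obtain ⟨A, hA, hA'⟩ := hu.bound
  obtain ⟨B, hB, hB'⟩ := hv.bound
  refine isLaurentCoeff_of (A * B) (lconv_norm_le hA' hB') ?_
  intro ε hε
  obtain ⟨N, hN⟩ := hu.small (ε := ε / B) (by positivity)
  obtain ⟨K, hK⟩ := hv.small (ε := ε / A) (by positivity)
  refine ⟨N + K, fun n hn => ?_⟩
  apply IsUltrametricDist.norm_tsum_le_of_forall_le_of_nonneg hε.le
  intro i
  rw [norm_mul]
  rcases lt_or_ge i N with h | h
  · have h1 := (lt_div_iff₀ hB).1 (hN i h)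
    have h2 := mul_le_mul_of_nonneg_left (hB' (n - i)) (norm_nonneg (u i))
    linarith
  · have h1 := (lt_div_iff₀ hA).1 (hK (n - i) (by lia))
    have h2 := mul_le_mul_of_nonneg_right (hA' i) (norm_nonneg (v (n - i)))
    linarith

theorem lconv_assoc [CompleteSpace C] [IsUltrametricDist C] {u v w : ℤ → C}
    (hu : IsLaurentCoeff u) (hv : IsLaurentCoeff v) (hw : IsLaurentCoeff w) :
    lconv (lconv u v) w = lconv u (lconv v w) := by
  funext n
  have hs : Summable (Function.uncurry fun i k : ℤ => u i * v (k - i) * w (n - k)) := by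
    apply summable_of_finite_big
    intro ε hε
    obtain ⟨A, hA, hA'⟩ := hu.bound
    obtain ⟨B, hB, hB'⟩ := hv.bound
    obtain ⟨D, hD, hD'⟩ := hw.bound
    obtain ⟨N, hN⟩ := hu.small (ε := ε / (B * D)) (by positivity)
    obtain ⟨K, hK⟩ := hv.small (ε := ε / (A * D)) (by positivity)
    obtain ⟨L, hL⟩ := hw.small (ε := ε / (A * B)) (by positivity)
    refine ((Set.finite_Icc N (n - L - K)).prod (Set.finite_Icc (N + K) (n - L))).subset ?_
    rintro ⟨i, k⟩ hi
    simp only [Set.mem_ofPred_eq, norm_mul, Function.uncurry_apply_pair] at hi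
    have a1 : N ≤ i := by
      by_contra! h
      have h1 := (lt_div_iff₀ (by positivity)).1 (hN i h)
      have h2 : ‖u i‖ * ‖v (k - i)‖ * ‖w (n - k)‖ ≤ ‖u i‖ * B * D := by
        gcongr
        · exact hB' _
        · exact hD' _
      nlinarith
    have a2 : K ≤ k - i := by
      by_contra! h
      have h1 := (lt_div_iff₀ (by positivity)).1 (hK _ h)
      have h2 : ‖u i‖ * ‖v (k - i)‖ * ‖w (n - k)‖ ≤ A * ‖v (k - i)‖ * D := by
        gcongr
        · exact hA' _
        · exact hD' _
      nlinarith
    have a3 : L ≤ n - k := by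
      by_contra! h
      have h1 := (lt_div_iff₀ (by positivity)).1 (hL _ h)
      have h2 : ‖u i‖ * ‖v (k - i)‖ * ‖w (n - k)‖ ≤ A * B * ‖w (n - k)‖ := by
        gcongr
        · exact hA' _
        · exact hB' _
      nlinarith
    simp only [Set.mem_prod, Set.mem_Icc]
    lia
  have h := hs.tsum_comm
  have e1 : lconv (lconv u v) w n = ∑' k : ℤ, ∑' i : ℤ, u i * v (k - i) * w (n - k) := by
    unfold lconv
    refine tsum_congr fun k => ?_
    rw [tsum_mul_right]
  have e2 : lconv u (lconv v w) n = ∑' i : ℤ, ∑' k : ℤ, u i * v (k - i) * w (n - k) := by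
    unfold lconv
    refine tsum_congr fun i => ?_
    rw [← tsum_mul_left, ← (Equiv.subRight i).tsum_eq]
    refine tsum_congr fun k => ?_
    simp only [Equiv.subRight_apply]
    rw [mul_assoc]
    congr 3
    ring
  rw [e1, e2, h]

theorem lone_norm_le (n : ℤ) : ‖(lone : ℤ → C) n‖ ≤ 1 := by
  unfold lone; split_ifs <;> simp

theorem lone_isLaurent : IsLaurentCoeff (lone : ℤ → C) := by
  refine isLaurentCoeff_of 1 lone_norm_le fun ε hε => ⟨0, fun n hn => ?_⟩
  rw [lone, if_neg hn.ne]; simpa using hε.le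

theorem lconv_lone (u : ℤ → C) : lconv u lone = u := by
  funext n
  unfold lconv lone
  rw [tsum_eq_single n]
  · simp
  · intro i hi
    rw [if_neg (by lia), mul_zero]

theorem lconv_sub [CompleteSpace C] [IsUltrametricDist C] {u v w : ℤ → C}
    (hu : IsLaurentCoeff u) (hv : IsLaurentCoeff v) (hw : IsLaurentCoeff w) :
    lconv u (v - w) = lconv u v - lconv u w := by
  funext n
  simp only [lconv, Pi.sub_apply, mul_sub]
  exact (lconv_summable hu hv n).tsum_sub (lconv_summable hu hw n)

theorem lconv_comm (u v : ℤ → C) : lconv u v = lconv v u := by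
  funext n
  unfold lconv
  rw [← (Equiv.subLeft n).tsum_eq]
  refine tsum_congr fun k => ?_
  simp only [Equiv.subLeft_apply, sub_sub_cancel]
  ring

theorem isLaurent_sub [IsUltrametricDist C] {u v : ℤ → C}
    (hu : IsLaurentCoeff u) (hv : IsLaurentCoeff v) : IsLaurentCoeff (u - v) := by
  obtain ⟨A, hA, hA'⟩ := hu.bound
  obtain ⟨B, hB, hB'⟩ := hv.bound
  refine isLaurentCoeff_of (A + B)
    (fun n => (norm_sub_le _ _).trans (add_le_add (hA' n) (hB' n))) fun ε hε => ?_
  obtain ⟨N, hN⟩ := hu.small (ε := ε / 2) (by positivity)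
  obtain ⟨K, hK⟩ := hv.small (ε := ε / 2) (by positivity)
  refine ⟨min N K, fun n hn => ?_⟩
  have h1 := hN n (hn.trans_le (min_le_left _ _))
  have h2 := hK n (hn.trans_le (min_le_right _ _))
  have h3 := norm_sub_le (u n) (v n)
  rw [Pi.sub_apply]
  linarith

/-- leftmost point of maximum -/
theorem exists_leftmost_max {f : ℤ → ℝ} (hf : Tendsto f atBot (𝓝 0)) {m : ℤ} (hm : 0 < f m)
    (hmax : ∀ n, f n ≤ f m) : ∃ n₀ : ℤ, (∀ n, f n ≤ f n₀) ∧ ∀ n, n < n₀ → f n < f n₀ := by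
  obtain ⟨N, hN⟩ := eventually_atBot.1 (hf.eventually (gt_mem_nhds hm))
  obtain ⟨a, ha, ha'⟩ := Int.exists_least_of_bdd (P := fun z => f m ≤ f z)
    ⟨N, fun z hz => by
      by_contra! h
      exact absurd (hN z h.le) (not_lt.2 hz)⟩ ⟨m, le_rfl⟩
  refine ⟨a, fun n => (hmax n).trans ha, fun n hn => ?_⟩
  by_contra! h
  have := ha' n (ha.trans h)
  lia

theorem exists_max_of_tendsto {f : ℤ → ℝ} (hf : Tendsto f cofinite (𝓝 0)) {m : ℤ}
    (hm : 0 < f m) : ∃ n₀ : ℤ, ∀ n, f n ≤ f n₀ := by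
  have h := hf.eventually (gt_mem_nhds hm)
  rw [eventually_cofinite] at h
  obtain ⟨a, ha, ha'⟩ := Set.exists_max_image _ f h ⟨m, by simp⟩
  refine ⟨a, fun n => ?_⟩
  by_cases hn : f n < f m
  · simp only [Set.mem_ofPred_eq, not_lt] at ha
    linarith
  · exact ha' n hn

theorem hasSum_norm_lt [IsUltrametricDist C] {f : ℤ → C} {s : C} (h : HasSum f s) {X : ℝ}
    (n₀ : ℤ) (hX : 0 < X) (hf : ∀ i, i ≠ n₀ → ‖f i‖ < X) (hs : ‖s‖ < X) : ‖f n₀‖ < X := by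
  classical
  have h1 := h.eventually (Metric.ball_mem_nhds s hX)
  obtain ⟨S, hS1, hS2⟩ := (h1.and (eventually_ge_atTop {n₀})).exists
  have hmem : n₀ ∈ S := by
    apply hS2; simp
  rw [dist_eq_norm] at hS1
  have h3 : ‖∑ i ∈ S.erase n₀, f i‖ < X := by
    rcases (S.erase n₀).eq_empty_or_nonempty with he | he
    · rw [he]; simpa using hX
    · obtain ⟨i, hi, hi'⟩ := IsUltrametricDist.exists_norm_finsetSum_le_of_nonempty he f
      exact hi'.trans_lt (hf i (Finset.ne_of_mem_erase hi))
  have h4 : f n₀ = ((∑ i ∈ S, f i - s) + s) + -(∑ i ∈ S.erase n₀, f i) := by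
    rw [← Finset.add_sum_erase S f hmem]; ring
  rw [h4]
  refine (IsUltrametricDist.norm_add_le_max _ _).trans_lt (max_lt ?_ (by rwa [norm_neg]))
  exact (IsUltrametricDist.norm_add_le_max _ _).trans_lt (max_lt hS1 hs)

theorem exists_weighted_max {u : ℤ → C} (hu : IsLaurentCoeff u) {L i : ℤ} (hi : L ≤ i)
    (hui : u i ≠ 0) {r : ℝ} (hr0 : 0 < r) (hr1 : r < 1) :
    ∃ n₀ : ℤ, L ≤ n₀ ∧ (∀ n, L ≤ n → r ^ n * ‖u n‖ ≤ r ^ n₀ * ‖u n₀‖) ∧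
      ∀ n, L ≤ n → n < n₀ → r ^ n * ‖u n‖ < r ^ n₀ * ‖u n₀‖ := by
  set f : ℤ → ℝ := fun n => if n < L then 0 else r ^ n * ‖u n‖ with hf
  obtain ⟨M, hM, hM'⟩ := hu.bound
  have hbot : Tendsto f atBot (𝓝 0) := by
    apply tendsto_const_nhds.congr'
    filter_upwards [eventually_lt_atBot L] with n hn
    simp [hf, hn]
  have htop : Tendsto f atTop (𝓝 0) := by
    have h1 : Tendsto (fun n : ℤ => r ^ n * M) atTop (𝓝 0) := by
      rw [← Nat.map_cast_int_atTop, tendsto_map'_iff]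
      have := (tendsto_pow_atTop_nhds_zero_of_lt_one hr0.le hr1).mul_const M
      rw [zero_mul] at this
      exact this.congr fun n => by simp
    refine squeeze_zero (fun n => ?_) (fun n => ?_) h1
    · simp only [hf]; split_ifs <;> positivity
    · simp only [hf]; split_ifs
      · positivity
      · exact mul_le_mul_of_nonneg_left (hM' n) (by positivity)
  have hcof : Tendsto f cofinite (𝓝 0) := by
    rw [Int.cofinite_eq]; exact hbot.sup htop
  have hfi : 0 < f i := by
    simp only [hf, if_neg hi.not_gt]
    have := norm_pos_iff.2 hui
    positivity
  obtain ⟨m, hm⟩ := exists_max_of_tendsto hcof hfi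
  obtain ⟨n₀, h1, h2⟩ := exists_leftmost_max hbot (hfi.trans_le (hm i)) hm
  have hn0 : L ≤ n₀ := by
    by_contra! h
    have h3 := hfi.trans_le (h1 i)
    simp [hf, h] at h3
  have key : ∀ n, L ≤ n → f n = r ^ n * ‖u n‖ := fun n hn => by
    simp only [hf, if_neg hn.not_gt]
  refine ⟨n₀, hn0, fun n hn => ?_, fun n hn hn' => ?_⟩
  · rw [← key n hn, ← key n₀ hn0]; exact h1 n
  · rw [← key n hn, ← key n₀ hn0]; exact h2 n hn'

theorem norm_mul_le_one_of_lconv [CompleteSpace C] [IsUltrametricDist C] {u v : ℤ → C}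
    (hu : IsLaurentCoeff u) (hv : IsLaurentCoeff v) (huv : lconv u v = lone) (i j : ℤ) :
    ‖u i‖ * ‖v j‖ ≤ 1 := by
  by_contra! hY
  have hui : u i ≠ 0 := by
    intro h; rw [h, norm_zero, zero_mul] at hY; linarith
  have hvj : v j ≠ 0 := by
    intro h; rw [h, norm_zero, mul_zero] at hY; linarith
  obtain ⟨A, hA, hA'⟩ := hu.bound
  obtain ⟨B, hB, hB'⟩ := hv.bound
  obtain ⟨N, hN⟩ := hu.small (ε := 1 / B) (by positivity)
  obtain ⟨K, hK⟩ := hv.small (ε := 1 / A) (by positivity)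
  obtain ⟨L, hL⟩ : ∃ L : ℤ, L ≤ N ∧ L ≤ K ∧ L ≤ i ∧ L ≤ j :=
    ⟨min (min N K) (min i j), by lia⟩
  obtain ⟨e, he⟩ : ∃ e : ℕ, (e : ℤ) = i + j - 2 * L := ⟨(i + j - 2 * L).toNat, by lia⟩
  obtain ⟨r, hr0, hr1, hr⟩ : ∃ r : ℝ, 0 < r ∧ r < 1 ∧ 1 < r ^ e * (‖u i‖ * ‖v j‖) := by
    have hcont : Tendsto (fun r : ℝ => r ^ e * (‖u i‖ * ‖v j‖)) (𝓝[<] 1)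
        (𝓝 (1 ^ e * (‖u i‖ * ‖v j‖))) :=
      (Continuous.tendsto (by fun_prop) 1).mono_left nhdsWithin_le_nhds
    rw [one_pow, one_mul] at hcont
    have h1 := hcont.eventually (lt_mem_nhds hY)
    have h2 : ∀ᶠ r : ℝ in 𝓝[<] 1, r < 1 := eventually_mem_nhdsWithin
    have h3 : ∀ᶠ r : ℝ in 𝓝[<] 1, 0 < r := nhdsWithin_le_nhds (lt_mem_nhds one_pos)
    obtain ⟨r, hr1, hr2, hr3⟩ := (h1.and (h2.and h3)).exists
    exact ⟨r, hr3, hr2, hr1⟩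
  obtain ⟨n₀, hn0, hn1, hn2⟩ := exists_weighted_max hu hL.2.2.1 hui hr0 hr1
  obtain ⟨m₀, hm0, hm1, hm2⟩ := exists_weighted_max hv hL.2.2.2 hvj hr0 hr1
  have hrn : ∀ a b : ℤ, r ^ a * ‖u a‖ * (r ^ b * ‖v b‖) = r ^ (a + b) * (‖u a‖ * ‖v b‖) := by
    intro a b
    rw [zpow_add₀ hr0.ne']; ring
  set X := ‖u n₀‖ * ‖v m₀‖ with hXdef
  have hX : 1 < X := by
    have h1 : r ^ (i + j) * (‖u i‖ * ‖v j‖) ≤ r ^ (n₀ + m₀) * X := by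
      rw [← hrn, ← hrn]
      exact mul_le_mul (hn1 i hL.2.2.1) (hm1 j hL.2.2.2) (by positivity) (by positivity)
    have h2 : r ^ (n₀ + m₀) ≤ r ^ (2 * L) :=
      zpow_le_zpow_right_of_le_one₀ hr0 hr1.le (by lia)
    have h3 : r ^ (i + j) = r ^ (2 * L) * r ^ e := by
      rw [← zpow_natCast, ← zpow_add₀ hr0.ne', he]; congr 1; ring
    have h4 : r ^ (n₀ + m₀) * X ≤ r ^ (2 * L) * X :=
      mul_le_mul_of_nonneg_right h2 (by positivity)
    rw [h3, mul_assoc] at h1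
    have h5 := le_of_mul_le_mul_left (h1.trans h4) (by positivity)
    linarith
  have hsum := (lconv_summable hu hv (n₀ + m₀)).hasSum
  have hval : ∑' a, u a * v (n₀ + m₀ - a) = lone (n₀ + m₀) := congrFun huv (n₀ + m₀)
  rw [hval] at hsum
  have hcontra := hasSum_norm_lt hsum (X := X) n₀ (by linarith) ?_
    ((lone_norm_le _).trans_lt hX)
  · rw [norm_mul, add_sub_cancel_left] at hcontra
    exact lt_irrefl _ hcontra
  intro a ha
  rw [norm_mul]
  rcases lt_or_ge a L with h | haL
  · have h1 := (lt_div_iff₀ hB).1 (hN a (by lia))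
    have h2 := mul_le_mul_of_nonneg_left (hB' (n₀ + m₀ - a)) (norm_nonneg (u a))
    linarith
  obtain ⟨b, hb⟩ : ∃ b, b = n₀ + m₀ - a := ⟨_, rfl⟩
  rw [← hb]
  rcases lt_or_ge b L with h | hbL
  · have h1 := (lt_div_iff₀ hA).1 (hK b (by lia))
    have h2 := mul_le_mul_of_nonneg_right (hA' a) (norm_nonneg (v b))
    linarith
  have hupos : 0 < r ^ n₀ * ‖u n₀‖ := by
    refine lt_of_lt_of_le ?_ (hn1 i hL.2.2.1)
    have := norm_pos_iff.2 hui
    positivity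
  have hvpos : 0 < r ^ m₀ * ‖v m₀‖ := by
    refine lt_of_lt_of_le ?_ (hm1 j hL.2.2.2)
    have := norm_pos_iff.2 hvj
    positivity
  have hlt : r ^ a * ‖u a‖ * (r ^ b * ‖v b‖) < r ^ n₀ * ‖u n₀‖ * (r ^ m₀ * ‖v m₀‖) := by
    rcases lt_or_gt_of_ne ha with h | h
    · exact mul_lt_mul_of_lt_of_le_of_nonneg_of_pos (hn2 a haL h) (hm1 b hbL)
        (by positivity) hvpos
    · exact (mul_le_mul_of_nonneg_right (hn1 a haL) (by positivity)).trans_lt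
        (mul_lt_mul_of_pos_left (hm2 b hbL (by lia)) hupos)
  rw [hrn, hrn, show a + b = n₀ + m₀ by lia] at hlt
  exact lt_of_mul_lt_mul_left hlt (by positivity)

theorem attained_of_lconv [CompleteSpace C] [IsUltrametricDist C] {u v : ℤ → C}
    (hu : IsLaurentCoeff u) (hv : IsLaurentCoeff v) (huv : lconv u v = lone) :
    ∃ n₀ : ℤ, ∀ n : ℤ, ‖u n‖ ≤ ‖u n₀‖ := by
  have hsum := (lconv_summable hu hv 0).hasSum
  have hval : ∑' a, u a * v (0 - a) = lone 0 := congrFun huv 0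
  rw [hval] at hsum
  have hex : ∃ i, 1 ≤ ‖u i * v (0 - i)‖ := by
    by_contra! h
    have h1 : Tendsto (fun i => ‖u i * v (0 - i)‖) cofinite (𝓝 0) := by
      simpa using hsum.summable.tendsto_cofinite_zero.norm
    have hne : ∃ m, u m * v (0 - m) ≠ 0 := by
      by_contra! h0
      have h2 : (fun a => u a * v (0 - a)) = fun _ => (0 : C) := funext h0
      rw [h2] at hsum
      have := hsum.unique hasSum_zero
      simp [lone] at this
    obtain ⟨m, hm⟩ := hne
    obtain ⟨k, hk⟩ := exists_max_of_tendsto h1 (norm_pos_iff.2 hm)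
    have h3 := IsUltrametricDist.norm_tsum_le_of_forall_le_of_nonneg (norm_nonneg _) hk
    rw [hval] at h3
    simp only [lone, if_true, norm_one] at h3
    linarith [h k]
  obtain ⟨i, hi⟩ := hex
  refine ⟨i, fun n => ?_⟩
  rw [norm_mul] at hi
  have h1 := norm_mul_le_one_of_lconv hu hv huv n (0 - i)
  have hpos : 0 < ‖v (0 - i)‖ := by
    by_contra! h
    have : ‖v (0 - i)‖ = 0 := le_antisymm h (norm_nonneg _)
    rw [this, mul_zero] at hi
    linarith
  exact le_of_mul_le_mul_right (h1.trans hi) hpos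

/-- inverse of a power series with coefficients of norm at most one, constant term one -/
theorem exists_inv_powerSeries [IsUltrametricDist C] (g : ℤ → C) (hg : ∀ n, ‖g n‖ ≤ 1)
    (hneg : ∀ n, n < 0 → g n = 0) (h0 : g 0 = 1) :
    ∃ k : ℤ → C, (∀ n, ‖k n‖ ≤ 1) ∧ (∀ n, n < 0 → k n = 0) ∧ lconv g k = lone := by
  set φ : PowerSeries C := PowerSeries.mk fun n : ℕ => g n with hφ
  have hc : PowerSeries.constantCoeff φ = 1 := by
    simp [hφ, ← PowerSeries.coeff_zero_eq_constantCoeff_apply, h0]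
  have hmul : φ * φ⁻¹ = 1 := PowerSeries.mul_inv_cancel φ (by rw [hc]; exact one_ne_zero)
  have hb : ∀ n : ℕ, ‖PowerSeries.coeff n φ⁻¹‖ ≤ 1 := by
    intro n
    induction n using Nat.strong_induction_on with
    | _ n ih =>
      rw [PowerSeries.coeff_inv, hc]
      split_ifs with hn
      · simp
      · rw [inv_one, neg_one_mul, norm_neg]
        apply IsUltrametricDist.norm_sum_le_of_forall_le_of_nonneg zero_le_one
        intro x hx
        split_ifs with hx2
        · rw [norm_mul, hφ, PowerSeries.coeff_mk]
          exact mul_le_one₀ (hg _) (norm_nonneg _) (ih _ hx2)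
        · simp
  refine ⟨fun n => if n < 0 then 0 else PowerSeries.coeff n.toNat φ⁻¹, ?_, ?_, ?_⟩
  · intro n
    dsimp only
    split_ifs
    · simp
    · exact hb _
  · intro n hn
    simp [hn]
  · funext n
    unfold lconv lone
    rcases lt_or_ge n 0 with hn | hn
    · rw [if_neg hn.ne]
      convert tsum_zero with i
      rcases lt_or_ge i 0 with hi | hi
      · rw [hneg i hi, zero_mul]
      · dsimp only
        rw [if_pos (by lia), mul_zero]
    · obtain ⟨m, rfl⟩ := Int.eq_ofNat_of_zero_le hn
      have hcm := congrArg (PowerSeries.coeff m) hmul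
      rw [PowerSeries.coeff_mul, PowerSeries.coeff_one,
        Finset.Nat.sum_antidiagonal_eq_sum_range_succ
          (fun a b => PowerSeries.coeff a φ * PowerSeries.coeff b φ⁻¹)] at hcm
      rw [tsum_eq_sum (s := (Finset.range (m + 1)).map Nat.castEmbedding), Finset.sum_map]
      · simp only [Int.natCast_eq_zero]
        rw [← hcm]
        refine Finset.sum_congr rfl fun a ha => ?_
        rw [Finset.mem_range] at ha
        simp only [Nat.castEmbedding_apply]
        rw [if_neg (by lia), hφ, PowerSeries.coeff_mk]
        congr 3
        lia
      · intro i hi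
        rcases lt_or_ge i 0 with h | h
        · rw [hneg i h, zero_mul]
        · dsimp only
          rw [if_pos, mul_zero]
          by_contra! h'
          apply hi
          rw [Finset.mem_map]
          refine ⟨i.toNat, ?_, ?_⟩
          · rw [Finset.mem_range]; lia
          · simp [h]

/-- geometric series -/
theorem exists_inv_one_sub [CompleteSpace C] [IsUltrametricDist C] {e : ℤ → C}
    (he : IsLaurentCoeff e) {r : ℝ} (hr : r < 1) (her : ∀ n, ‖e n‖ ≤ r) :
    ∃ w : ℤ → C, IsLaurentCoeff w ∧ lconv (lone - e) w = lone := by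
  have hr0 : 0 ≤ r := (norm_nonneg _).trans (her 0)
  let E : ℕ → ℤ → C := fun k => (lconv e)^[k] lone
  have hE0 : E 0 = lone := rfl
  have hEs : ∀ k, E (k + 1) = lconv e (E k) := fun k => Function.iterate_succ_apply' _ _ _
  have hEL : ∀ k, IsLaurentCoeff (E k) := by
    intro k
    induction k with
    | zero => exact lone_isLaurent
    | succ k ih => rw [hEs]; exact lconv_isLaurent he ih
  have hEn : ∀ k n, ‖E k n‖ ≤ r ^ k := by
    intro k
    induction k with
    | zero => intro n; rw [pow_zero]; exact lone_norm_le n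
    | succ k ih => intro n; rw [hEs, pow_succ']; exact lconv_norm_le her ih n
  -- partial sums
  let S : ℕ → ℤ → C := fun k n => ∑ l ∈ Finset.range k, E l n
  have hS0 : S 0 = 0 := by funext n; simp [S]
  have hSs : ∀ k, S (k + 1) = S k - (fun n => - E k n) := by
    intro k; funext n; simp [S, Finset.sum_range_succ]
  have hnegL : ∀ k, IsLaurentCoeff (fun n => - E k n) := by
    intro k
    have := hEL k
    simpa [IsLaurentCoeff] using this
  have hSL : ∀ k, IsLaurentCoeff (S k) := by
    intro k
    induction k with
    | zero =>
      rw [hS0]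
      exact isLaurentCoeff_of 0 (by simp) fun ε hε => ⟨0, fun n _ => by simpa using hε.le⟩
    | succ k ih => rw [hSs]; exact isLaurent_sub ih (hnegL k)
  have hconvS : ∀ k, lconv e (S k) = S (k + 1) - lone := by
    intro k
    induction k with
    | zero =>
      funext n
      simp [S, hE0, lconv]
    | succ k ih =>
      rw [hSs k, lconv_sub he (hSL k) (hnegL k), ih]
      have h1 : lconv e (fun n => - E k n) = fun n => - E (k + 1) n := by
        funext n
        rw [hEs]
        simp [lconv, tsum_neg]
      rw [h1, hSs (k + 1)]
      abel
  have hsum : ∀ n, Summable (fun k => E k n) := fun n =>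
    Summable.of_norm_bounded (summable_geometric_of_lt_one hr0 hr) (fun k => hEn k n)
  let w : ℤ → C := fun n => ∑' k, E k n
  have hwS : ∀ k n, ‖(w - S k) n‖ ≤ r ^ k := by
    intro k n
    have h1 : (w - S k) n = ∑' l, E (l + k) n := by
      have := (hsum n).sum_add_tsum_nat_add k
      simp only [Pi.sub_apply, w, S]
      rw [← this]; ring
    rw [h1]
    apply IsUltrametricDist.norm_tsum_le_of_forall_le_of_nonneg (by positivity)
    intro l
    exact (hEn _ n).trans (pow_le_pow_of_le_one hr0 hr.le (by lia))
  have hpow : ∀ ε : ℝ, 0 < ε → ∃ k : ℕ, r ^ k < ε := fun ε hε => exists_pow_lt_of_lt_one hε hr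
  have hwL : IsLaurentCoeff w := by
    refine isLaurentCoeff_of 1 (fun n => ?_) fun ε hε => ?_
    · have := hwS 0 n
      rwa [hS0, sub_zero, pow_zero] at this
    · obtain ⟨k, hk⟩ := hpow (ε / 2) (by positivity)
      obtain ⟨N, hN⟩ := (hSL k).small (ε := ε / 2) (by positivity)
      refine ⟨N, fun n hn => ?_⟩
      have h1 := hN n hn
      have h2 := hwS k n
      have h3 : w n = (w - S k) n + S k n := by simp
      rw [h3]
      have := norm_add_le ((w - S k) n) (S k n)
      linarith
  refine ⟨w, hwL, ?_⟩
  rw [lconv_comm, lconv_sub hwL lone_isLaurent he, lconv_lone, lconv_comm]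
  funext n
  rw [← sub_eq_zero, ← norm_le_zero_iff]
  refine le_of_forall_pos_le_add fun ε hε => ?_
  obtain ⟨k, hk⟩ := hpow ε hε
  have h1 : (w - lconv e w) n - lone n = (w - S (k + 1)) n + - (lconv e (w - S k)) n := by
    rw [lconv_sub he hwL (hSL k), hconvS]
    simp only [Pi.sub_apply]; ring
  rw [h1, zero_add]
  refine (IsUltrametricDist.norm_add_le_max _ _).trans (max_le ?_ ?_)
  · exact ((hwS (k + 1) n).trans (pow_le_pow_of_le_one hr0 hr.le (by lia))).trans hk.le
  · rw [norm_neg]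
    have h2 := lconv_norm_le her (hwS k) n
    have h3 : r * r ^ k ≤ r ^ k := by
      have : 0 ≤ r ^ k := by positivity
      nlinarith
    linarith

theorem exists_inv_normalized [CompleteSpace C] [IsUltrametricDist C] {c : ℤ → C}
    (hc : IsLaurentCoeff c) (h0 : c 0 = 1) (h1 : ∀ n, ‖c n‖ ≤ 1) (hneg : ∀ n, n < 0 → ‖c n‖ < 1) :
    ∃ w : ℤ → C, IsLaurentCoeff w ∧ lconv c w = lone := by
  set g : ℤ → C := fun n => if n < 0 then 0 else c n with hg
  set h : ℤ → C := fun n => if n < 0 then - c n else 0 with hh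
  have hcgh : c = g - h := by
    funext n; simp only [hg, hh, Pi.sub_apply]; split_ifs <;> simp
  have hgL : IsLaurentCoeff g := by
    refine isLaurentCoeff_of 1 (fun n => ?_) fun ε hε => ⟨0, fun n hn => ?_⟩
    · simp only [hg]; split_ifs
      · simp
      · exact h1 n
    · simp [hg, hn, hε.le]
  have hhc : ∀ n, ‖h n‖ ≤ ‖c n‖ := by
    intro n; simp only [hh]; split_ifs <;> simp
  have hhL : IsLaurentCoeff h := by
    refine isLaurentCoeff_of 1 (fun n => (hhc n).trans (h1 n)) fun ε hε => ?_
    obtain ⟨N, hN⟩ := hc.small hε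
    exact ⟨N, fun n hn => (hhc n).trans (hN n hn).le⟩
  obtain ⟨r, hr, hhr⟩ : ∃ r : ℝ, r < 1 ∧ ∀ n, ‖h n‖ ≤ r := by
    by_cases hz : ∃ m, h m ≠ 0
    · obtain ⟨m, hm⟩ := hz
      have ht : Tendsto (fun n => ‖h n‖) cofinite (𝓝 0) := by
        rw [Int.cofinite_eq]
        refine hhL.2.sup (tendsto_const_nhds.congr' ?_)
        filter_upwards [eventually_ge_atTop 0] with n hn
        simp [hh, hn.not_gt]
      obtain ⟨k, hk⟩ := exists_max_of_tendsto ht (norm_pos_iff.2 hm)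
      refine ⟨‖h k‖, ?_, hk⟩
      by_cases hk0 : k < 0
      · exact (hhc k).trans_lt (hneg k hk0)
      · simp [hh, hk0]
    · push Not at hz
      exact ⟨0, one_pos, fun n => by simp [hz n]⟩
  obtain ⟨k, hk1, hk0, hgk⟩ := exists_inv_powerSeries g
    (fun n => by simp only [hg]; split_ifs <;> simp [h1]) (fun n hn => by simp [hg, hn])
    (by simp [hg, h0])
  have hkL : IsLaurentCoeff k :=
    isLaurentCoeff_of 1 hk1 fun ε hε => ⟨0, fun n hn => by simp [hk0 n hn, hε.le]⟩
  obtain ⟨w, hwL, hw⟩ := exists_inv_one_sub (lconv_isLaurent hkL hhL) hr (fun n => by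
    simpa using lconv_norm_le hk1 hhr n)
  refine ⟨lconv k w, lconv_isLaurent hkL hwL, ?_⟩
  rw [← lconv_assoc hc hkL hwL, lconv_comm c k, hcgh, lconv_sub hkL hgL hhL, lconv_comm k g, hgk,
    hw]

theorem exists_inv_of_attained [CompleteSpace C] [IsUltrametricDist C] {c : ℤ → C}
    (hc : IsLaurentCoeff c) (hc0 : c ≠ 0) (h : ∃ n₀ : ℤ, ∀ n : ℤ, ‖c n‖ ≤ ‖c n₀‖) :
    ∃ v : ℤ → C, IsLaurentCoeff v ∧ lconv c v = lone := by
  obtain ⟨m, hm⟩ := h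
  obtain ⟨q, hq⟩ := Function.ne_iff.1 hc0
  have hpos : 0 < ‖c m‖ := (norm_pos_iff.2 hq).trans_le (hm q)
  obtain ⟨s, hs1, hs2⟩ := exists_leftmost_max hc.2 hpos hm
  have hspos : 0 < ‖c s‖ := hpos.trans_le (hs1 m)
  have hsne : c s ≠ 0 := norm_pos_iff.1 hspos
  have hshift : ∀ x : ℤ → C, IsLaurentCoeff x → IsLaurentCoeff fun n => (c s)⁻¹ * x (n + s) := by
    intro x hx
    obtain ⟨M, _, hM⟩ := hx.bound
    refine isLaurentCoeff_of (‖c s‖⁻¹ * M) (fun n => ?_) fun ε hε => ?_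
    · rw [norm_mul, norm_inv]
      exact mul_le_mul_of_nonneg_left (hM _) (by positivity)
    · obtain ⟨N, hN⟩ := hx.small (ε := ε * ‖c s‖) (by positivity)
      refine ⟨N - s, fun n hn => ?_⟩
      rw [norm_mul, norm_inv, inv_mul_le_iff₀ hspos, mul_comm]
      exact (hN _ (by lia)).le
  obtain ⟨w, hwL, hw⟩ := exists_inv_normalized (hshift c hc) (by simp [hsne])
    (fun n => by
      rw [norm_mul, norm_inv, inv_mul_le_iff₀ hspos, mul_one]; exact hs1 _)
    (fun n hn => by
      rw [norm_mul, norm_inv, inv_mul_lt_iff₀ hspos, mul_one]; exact hs2 _ (by lia))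
  refine ⟨_, hshift w hwL, ?_⟩
  rw [← hw]
  funext n
  unfold lconv
  rw [← (Equiv.addRight s).tsum_eq]
  refine tsum_congr fun i => ?_
  simp only [Equiv.coe_addRight]
  rw [show n - (i + s) + s = n - i by ring]
  ring

end LaurentAux

theorem laurent_isUnit_iff_inf_attained (p : ℕ) (hp : p.Prime)
    (C : Type*) [NontriviallyNormedField C] [IsAlgClosed C] [CompleteSpace C]
    [IsUltrametricDist C]
    (hnorm : ‖(p : C)‖ = (p : ℝ)⁻¹)
    (hval : ∀ x : C, x ≠ 0 → ∃ q : ℚ, ‖x‖ = (p : ℝ) ^ (-(q : ℝ)))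
    (hval' : ∀ q : ℚ, ∃ x : C, x ≠ 0 ∧ ‖x‖ = (p : ℝ) ^ (-(q : ℝ)))
    (c : ℤ → C) (hc : IsLaurentCoeff c) (hc0 : c ≠ 0) :
    (∃ v : ℤ → C, IsLaurentCoeff v ∧ lconv c v = lone) ↔
      ∃ n₀ : ℤ, ∀ n : ℤ, ‖c n‖ ≤ ‖c n₀‖ := by
  exact ⟨fun ⟨v, hv, h⟩ => attained_of_lconv hc hv h, exists_inv_of_attained hc hc0⟩
end

section
/- Let ℓ be a prime number different from p and let M = (O_C[[T,T⁻¹⟩[1/p])^× be the group of units. Let deg : M → ℤ be the group homomorphism sending a unit u to the integer k appearing in its unique factorization u = c·T^k·u₊·u₋ (with c ∈ C^×, u₊ ∈ 1 + T·O_C[[T]], u₋ ∈ 1 + T⁻¹·m_C⟨T⁻¹⟩). Then the maps M/M^{ℓⁿ} → ℤ/ℓⁿℤ induced by deg yield, in the inverse limit, a group isomorphism lim_n M/M^{ℓⁿ} ≅ lim_n ℤ/ℓⁿℤ = ℤ_ℓ. -/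
/-!
Statement 7: `C` is an algebraically closed field, complete for a valuation `v_p`
with `v_p(p) = 1` and `v_p(C^×) = ℚ`; `ℓ ≠ p` is a prime.  `M` is the unit group
of the ring `O_C[[T,T⁻¹⟩[1/p]` of "ghost circle" functions, whose elements are
coefficient sequences `ℤ → C` (bounded norms, tending to `0` at `-∞`) with the
convolution product.  Given the degree homomorphism `deg : M → ℤ` (the exponent
`k` in the unique factorization `u = c·T^k·u₊·u₋`), the maps
`M/M^{ℓⁿ} → ℤ/ℓⁿℤ` induced by `deg` yield, in the inverse limit, a group
isomorphism `lim_n M/M^{ℓⁿ} ≅ lim_n ℤ/ℓⁿℤ = ℤ_ℓ`.  The bijectivity of the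
induced map of inverse limits is expressed elementwise: compatible sequences of
classes are represented by sequences `u : ℕ → M` with
`u (n+1) ≡ u n mod M^{ℓⁿ}`, the class of such a sequence is trivial iff
`u n ∈ M^{ℓⁿ}` for all `n`, and elements of `ℤ_ℓ = lim ℤ/ℓⁿℤ` are represented
by sequences `k : ℕ → ℤ` with `ℓⁿ ∣ k (n+1) - k n`.
-/

open Filter Topology

/-- Convolution powers. -/
noncomputable def lconvPow {C : Type*} [NormedField C] (w : ℤ → C) : ℕ → (ℤ → C)
  | 0 => lone
  | n + 1 => lconv w (lconvPow w n)

/-- Membership in `M = (O_C[[T,T⁻¹⟩[1/p])^×`. -/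
noncomputable def IsLaurentUnit {C : Type*} [NormedField C] (u : ℤ → C) : Prop :=
  IsLaurentCoeff u ∧ ∃ v : ℤ → C, IsLaurentCoeff v ∧ lconv u v = lone

namespace GhostAux

/-- Existence of `N`-th roots of power series with constant coefficient `1`. -/
theorem exists_root {R : Type*} [CommRing R] {N : ℕ} (hN0 : N ≠ 0) (hN : IsUnit (N : R))
    (f : PowerSeries R) (hf : PowerSeries.constantCoeff f = 1) :
    ∃ r : PowerSeries R, r ^ N = f ∧ PowerSeries.constantCoeff r = 1 := by
  have H := (inferInstance : HenselianRing (PowerSeries R)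
    (Ideal.span {PowerSeries.X} : Ideal (PowerSeries R)))
  obtain ⟨r, hr, hr1⟩ := H.is_henselian (Polynomial.X ^ N - Polynomial.C f)
    (Polynomial.monic_X_pow_sub_C f hN0) 1
    (by
      rw [Ideal.mem_span_singleton, PowerSeries.X_dvd_iff]
      simp [hf])
    (by
      apply IsUnit.map
      simp only [Polynomial.derivative_sub, Polynomial.derivative_X_pow, Polynomial.derivative_C]
      simp only [sub_zero, Polynomial.eval_mul, Polynomial.eval_pow, Polynomial.eval_X, one_pow,
        mul_one, Polynomial.eval_C]
      simpa using hN.map (PowerSeries.C (R := R)))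
  refine ⟨r, ?_, ?_⟩
  · simpa [Polynomial.IsRoot, sub_eq_zero] using hr
  · rw [Ideal.mem_span_singleton, PowerSeries.X_dvd_iff] at hr1
    simpa [sub_eq_zero] using hr1

theorem root_dvd {R : Type*} [CommRing R] {N : ℕ} (hN : IsUnit (N : R))
    (r : PowerSeries R) (hr : PowerSeries.constantCoeff r = 1) (d : PowerSeries R)
    (h : d ∣ r ^ N - 1) : d ∣ r - 1 := by
  have h1 : (r - 1) * ∑ i ∈ Finset.range N, r ^ i = r ^ N - 1 := mul_geom_sum r N
  have h2 : IsUnit (∑ i ∈ Finset.range N, r ^ i) := by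
    rw [PowerSeries.isUnit_iff_constantCoeff]
    simpa [map_sum, hr] using hN
  rw [← h1] at h
  exact (h2.dvd_mul_right).1 h

theorem newton_step {P : Type*} [CommRing P] {N : ℕ} (e d r x : P) (he : e * (N : P) = 1)
    (hr : d ∣ r - 1) (hx : d ∣ x - 1) (j : ℕ) (hj : d ^ j ∣ r - x) :
    d ∣ (x + e * (r ^ N - x ^ N)) - 1 ∧ d ^ (j + 1) ∣ r - (x + e * (r ^ N - x ^ N)) := by
  have hrN : ∀ i, d ∣ r ^ i - 1 := fun i => hr.trans (sub_one_dvd_pow_sub_one r i)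
  have hxN : ∀ i, d ∣ x ^ i - 1 := fun i => hx.trans (sub_one_dvd_pow_sub_one x i)
  constructor
  · have : (x + e * (r ^ N - x ^ N)) - 1 = (x - 1) + e * ((r ^ N - 1) - (x ^ N - 1)) := by ring
    rw [this]
    exact dvd_add hx (Dvd.dvd.mul_left (dvd_sub (hrN N) (hxN N)) _)
  · have h1 : (∑ i ∈ Finset.range N, r ^ i * x ^ (N - 1 - i)) * (r - x) = r ^ N - x ^ N :=
      (Commute.all r x).geom_sum₂_mul N
    have h2 : d ∣ (N : P) - ∑ i ∈ Finset.range N, r ^ i * x ^ (N - 1 - i) := by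
      have : (N : P) = ∑ i ∈ Finset.range N, (1 : P) := by simp
      rw [this, ← Finset.sum_sub_distrib]
      refine Finset.dvd_sum fun i _ => ?_
      have : (1 : P) - r ^ i * x ^ (N - 1 - i)
        = -((r ^ i - 1) * x ^ (N - 1 - i) + (x ^ (N - 1 - i) - 1)) := by ring
      rw [this, dvd_neg]
      exact dvd_add (Dvd.dvd.mul_right (hrN i) _) (hxN _)
    have h3 : r - (x + e * (r ^ N - x ^ N)) = (r - x) * (e *
        ((N : P) - ∑ i ∈ Finset.range N, r ^ i * x ^ (N - 1 - i))) := by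
      rw [← h1, mul_sub e (N : P), he]; ring
    rw [h3, pow_succ]
    exact mul_dvd_mul hj (Dvd.dvd.mul_left h2 _)

theorem root_mem {P : Type*} [CommRing P] {N : ℕ} (S : Subring P) (e d r : P)
    (he : e * (N : P) = 1) (heS : e ∈ S) (hr : d ∣ r - 1) (hf : r ^ N ∈ S) (j : ℕ) :
    ∃ x ∈ S, d ∣ x - 1 ∧ d ^ j ∣ r - x := by
  induction j with
  | zero => exact ⟨1, S.one_mem, by simp, by simp⟩
  | succ j ih =>
    obtain ⟨x, hx, h1, h2⟩ := ih
    exact ⟨x + e * (r ^ N - x ^ N),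
      S.add_mem hx (S.mul_mem heS (S.sub_mem hf (S.pow_mem hx N))),
      newton_step e d r x he hr h1 j h2⟩

/-- Power series congruent to a polynomial modulo `d`. -/
noncomputable def polyMod {R : Type*} [CommRing R] (d : PowerSeries R) : Subring (PowerSeries R) :=
  ((Ideal.Quotient.mk (Ideal.span {d})).comp
    (Polynomial.coeToPowerSeries.ringHom (R := R))).range.comap (Ideal.Quotient.mk (Ideal.span {d}))

theorem mem_polyMod {R : Type*} [CommRing R] (d g : PowerSeries R) :
    g ∈ polyMod d ↔ ∃ q : Polynomial R, d ∣ g - (q : PowerSeries R) := by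
  simp only [polyMod, Subring.mem_comap, RingHom.mem_range, RingHom.comp_apply]
  refine exists_congr fun q => ?_
  rw [eq_comm, Ideal.Quotient.eq, Ideal.mem_span_singleton]
  rfl

theorem root_polyMod {R : Type*} [CommRing R] {N : ℕ} (hN : IsUnit (N : R))
    (r : PowerSeries R) (hr : PowerSeries.constantCoeff r = 1) (d : R)
    (h : PowerSeries.C d ∣ r ^ N - 1) (j : ℕ)
    (hj : ∃ q : Polynomial R, PowerSeries.C (d ^ j) ∣ r ^ N - (q : PowerSeries R)) :
    ∃ q : Polynomial R, PowerSeries.C (d ^ j) ∣ r - (q : PowerSeries R) := by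
  obtain ⟨e, he⟩ := hN.exists_left_inv
  have he' : PowerSeries.C e * (N : PowerSeries R) = 1 := by
    rw [← map_natCast (PowerSeries.C (R := R)), ← map_mul, he, map_one]
  rw [← mem_polyMod] at hj ⊢
  obtain ⟨x, hx, -, h2⟩ := root_mem (polyMod (PowerSeries.C (d ^ j))) (PowerSeries.C e)
    (PowerSeries.C d) r he' ((mem_polyMod _ _).2 ⟨Polynomial.C e, by simp⟩)
    (root_dvd hN r hr _ h) hj j
  obtain ⟨q, hq⟩ := (mem_polyMod _ _).1 hx
  refine (mem_polyMod _ _).2 ⟨q, ?_⟩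
  rw [← map_pow] at h2
  simpa using dvd_add h2 hq

end GhostAux

namespace GhostAux

section Conv
variable {C : Type*} [NormedField C]

theorem lc_small {u : ℤ → C} (hu : IsLaurentCoeff u) {ε : ℝ} (hε : 0 < ε) :
    ∃ K : ℤ, ∀ m ≤ K, ‖u m‖ < ε := by
  have := hu.2.eventually (gt_mem_nhds hε)
  exact Filter.eventually_atBot.1 this

theorem lc_bdd {u : ℤ → C} (hu : IsLaurentCoeff u) : ∃ B : ℝ, 0 < B ∧ ∀ m, ‖u m‖ ≤ B := by
  obtain ⟨B, hB⟩ := hu.1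
  exact ⟨max B 1, by positivity, fun m => (hB m).trans (le_max_left _ _)⟩

theorem lconv_comm (u v : ℤ → C) : lconv u v = lconv v u := by
  funext n
  unfold lconv
  rw [← (Equiv.subLeft n).tsum_eq]
  refine tsum_congr fun i => ?_
  simp [mul_comm]

theorem lconv_reflect (u v : ℤ → C) :
    lconv (fun n => u (-n)) (fun n => v (-n)) = fun n => lconv u v (-n) := by
  funext n
  unfold lconv
  rw [← (Equiv.neg ℤ).tsum_eq]
  refine tsum_congr fun i => ?_
  simp only [Equiv.neg_apply, neg_neg]
  congr 2
  ring

theorem lconv_single_left (k : ℤ) (c : C) (v : ℤ → C) (n : ℤ) :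
    lconv (fun m => if m = k then c else 0) v n = c * v (n - k) := by
  unfold lconv
  rw [tsum_eq_single k]
  · simp
  · intro b hb
    simp [hb]

theorem lone_lconv (v : ℤ → C) : lconv lone v = v := by
  funext n
  have := lconv_single_left 0 (1 : C) v n
  rw [one_mul, sub_zero] at this
  exact this

theorem isLaurentCoeff_single (k : ℤ) (c : C) :
    IsLaurentCoeff (fun m : ℤ => if m = k then c else 0) := by
  constructor
  · refine ⟨‖c‖, fun n => ?_⟩
    by_cases h : n = k <;> simp [h]
  · refine tendsto_const_nhds.congr' ?_
    filter_upwards [Filter.eventually_lt_atBot k] with n hn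
    simp [hn.ne]

theorem isLaurentCoeff_lone : IsLaurentCoeff (lone : ℤ → C) := isLaurentCoeff_single 0 1

variable [CompleteSpace C] [IsUltrametricDist C]

theorem summable_of_eps {ι : Type*} (f : ι → C)
    (h : ∀ ε > 0, ∃ s : Set ι, s.Finite ∧ ∀ i ∉ s, ‖f i‖ < ε) : Summable f := by
  apply NonarchimedeanAddGroup.summable_of_tendsto_cofinite_zero
  rw [NormedAddGroup.tendsto_nhds_zero]
  intro ε hε
  obtain ⟨s, hs, h⟩ := h ε hε
  rw [Filter.eventually_cofinite]
  refine hs.subset fun i hi => ?_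
  by_contra hn
  exact hi (h i hn)

theorem isLaurentCoeff_lconv {u v : ℤ → C} (hu : IsLaurentCoeff u) (hv : IsLaurentCoeff v) :
    IsLaurentCoeff (lconv u v) := by
  obtain ⟨A, hA0, hA⟩ := lc_bdd hu
  obtain ⟨B, hB0, hB⟩ := lc_bdd hv
  constructor
  · refine ⟨A * B, fun n => ?_⟩
    apply IsUltrametricDist.norm_tsum_le_of_forall_le
    intro i
    rw [norm_mul]
    exact mul_le_mul (hA _) (hB _) (norm_nonneg _) hA0.le
  · rw [Metric.tendsto_nhds]
    intro ε hε
    obtain ⟨K, hK⟩ := lc_small hu (ε := ε / 2 / B) (by positivity)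
    obtain ⟨L, hL⟩ := lc_small hv (ε := ε / 2 / A) (by positivity)
    filter_upwards [Filter.eventually_le_atBot (K + L)] with n hn
    rw [dist_zero_right, norm_norm]
    refine lt_of_le_of_lt (b := ε / 2) ?_ (by linarith)
    apply IsUltrametricDist.norm_tsum_le_of_forall_le
    intro i
    rw [norm_mul]
    by_cases hi : i ≤ K
    · calc ‖u i‖ * ‖v (n - i)‖ ≤ (ε / 2 / B) * B :=
            mul_le_mul (hK i hi).le (hB _) (norm_nonneg _) (by positivity)
        _ = ε / 2 := by field_simp
    · calc ‖u i‖ * ‖v (n - i)‖ ≤ A * (ε / 2 / A) :=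
            mul_le_mul (hA _) (hL (n - i) (by lia)).le (norm_nonneg _) (by positivity)
        _ = ε / 2 := by field_simp

theorem summable_triple {u v w : ℤ → C} (hu : IsLaurentCoeff u) (hv : IsLaurentCoeff v)
    (hw : IsLaurentCoeff w) (n : ℤ) :
    Summable (Function.uncurry fun j i : ℤ => u j * v (i - j) * w (n - i)) := by
  obtain ⟨A, hA0, hA⟩ := lc_bdd hu
  obtain ⟨B, hB0, hB⟩ := lc_bdd hv
  obtain ⟨D, hD0, hD⟩ := lc_bdd hw
  apply summable_of_eps
  intro ε hε
  obtain ⟨K, hK⟩ := lc_small hu (ε := ε / B / D) (by positivity)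
  obtain ⟨L, hL⟩ := lc_small hv (ε := ε / A / D) (by positivity)
  obtain ⟨M, hM⟩ := lc_small hw (ε := ε / A / B) (by positivity)
  refine ⟨Set.Icc K (n - L - M) ×ˢ Set.Icc (K + L) (n - M),
    (Set.finite_Icc _ _).prod (Set.finite_Icc _ _), ?_⟩
  rintro ⟨j, i⟩ h
  simp only [Function.uncurry_apply_pair, norm_mul]
  have hu' := norm_nonneg (u j)
  have hv' := norm_nonneg (v (i - j))
  have hw' := norm_nonneg (w (n - i))
  by_cases h1 : j ≤ K
  · calc ‖u j‖ * ‖v (i - j)‖ * ‖w (n - i)‖ ≤ ‖u j‖ * B * D := by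
          gcongr <;> first | exact hB _ | exact hD _
      _ < (ε / B / D) * B * D := by gcongr; exact hK j h1
      _ = ε := by field_simp
  by_cases h2 : i - j ≤ L
  · calc ‖u j‖ * ‖v (i - j)‖ * ‖w (n - i)‖ ≤ A * ‖v (i - j)‖ * D := by
          gcongr <;> first | exact hA _ | exact hD _
      _ < A * (ε / A / D) * D := by gcongr; exact hL _ h2
      _ = ε := by field_simp
  by_cases h3 : n - i ≤ M
  · calc ‖u j‖ * ‖v (i - j)‖ * ‖w (n - i)‖ ≤ A * B * ‖w (n - i)‖ := by
          gcongr <;> first | exact hA _ | exact hB _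
      _ < A * B * (ε / A / B) := by gcongr; exact hM _ h3
      _ = ε := by field_simp
  exfalso
  apply h
  simp only [Set.mem_prod, Set.mem_Icc]
  lia

theorem lconv_assoc {u v w : ℤ → C} (hu : IsLaurentCoeff u) (hv : IsLaurentCoeff v)
    (hw : IsLaurentCoeff w) : lconv (lconv u v) w = lconv u (lconv v w) := by
  funext n
  have h := (summable_triple hu hv hw n).tsum_comm
  calc lconv (lconv u v) w n = ∑' (i : ℤ) (j : ℤ), u j * v (i - j) * w (n - i) := by
        unfold lconv
        exact tsum_congr fun i => tsum_mul_right.symm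
    _ = ∑' (j : ℤ) (i : ℤ), u j * v (i - j) * w (n - i) := h
    _ = lconv u (lconv v w) n := by
        unfold lconv
        refine tsum_congr fun j => ?_
        rw [← tsum_mul_left, ← (Equiv.addRight j).tsum_eq]
        refine tsum_congr fun k => ?_
        simp only [Equiv.coe_addRight]
        rw [mul_assoc]
        rw [add_sub_cancel_right, sub_sub n j k, add_comm j k]

/-- The monoid of Laurent coefficient sequences. -/
@[ext]
structure Lau (C : Type*) [NormedField C] where
  /-- the coefficients -/
  val : ℤ → C
  /-- they satisfy the growth conditions -/
  prop : IsLaurentCoeff val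

noncomputable instance : CommMonoid (Lau C) where
  mul u v := ⟨lconv u.1 v.1, isLaurentCoeff_lconv u.2 v.2⟩
  one := ⟨lone, isLaurentCoeff_lone⟩
  mul_assoc u v w := Lau.ext (lconv_assoc u.2 v.2 w.2)
  mul_comm u v := Lau.ext (lconv_comm u.1 v.1)
  one_mul u := Lau.ext (lone_lconv u.1)
  mul_one u := Lau.ext ((lconv_comm _ _).trans (lone_lconv u.1))

theorem Lau.val_mul (u v : Lau C) : (u * v).1 = lconv u.1 v.1 := rfl
theorem Lau.val_one : (1 : Lau C).1 = lone := rfl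
theorem Lau.val_pow (u : Lau C) (n : ℕ) : (u ^ n).1 = lconvPow u.1 n := by
  induction n with
  | zero => rw [pow_zero]; rfl
  | succ n ih => rw [pow_succ', Lau.val_mul, ih]; rfl

theorem Lau.isUnit_iff (u : Lau C) : IsUnit u ↔ IsLaurentUnit u.1 := by
  rw [isUnit_iff_exists_inv]
  constructor
  · rintro ⟨v, hv⟩
    exact ⟨u.2, v.1, v.2, congrArg Lau.val hv⟩
  · rintro ⟨-, v, hv, h⟩
    exact ⟨⟨v, hv⟩, Lau.ext h⟩

/-- The monomial `c T^k`. -/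
def Lau.mono (k : ℤ) (c : C) : Lau C :=
  ⟨fun m => if m = k then c else 0, isLaurentCoeff_single k c⟩

theorem Lau.mono_mul (k m : ℤ) (c d : C) :
    Lau.mono k c * Lau.mono m d = Lau.mono (k + m) (c * d) := by
  apply Lau.ext
  funext n
  rw [Lau.val_mul]
  refine (lconv_single_left k c _ n).trans ?_
  simp only [Lau.mono]
  have : n - k = m ↔ n = k + m := by constructor <;> intro h <;> lia
  simp [this]

theorem Lau.mono_zero_one : Lau.mono 0 (1 : C) = 1 := rfl

theorem Lau.mono_pow (k : ℤ) (c : C) (n : ℕ) :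
    Lau.mono k c ^ n = Lau.mono (n * k) (c ^ n) := by
  induction n with
  | zero => simp [Lau.mono_zero_one]
  | succ n ih =>
    rw [pow_succ, ih, Lau.mono_mul, pow_succ]
    congr 1
    push_cast
    ring

theorem Lau.isUnit_mono (k : ℤ) : IsUnit (Lau.mono k (1 : C)) := by
  refine IsUnit.of_mul_eq_one (Lau.mono (-k) 1) ?_
  rw [Lau.mono_mul, ← Lau.mono_zero_one]
  simp

/-- The degree of a factorized monomial is the expected one. -/
theorem deg_unique (k d : ℤ) (c : C) (hc : c ≠ 0) (a b : ℤ → C)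
    (ha0 : a 0 = 1) (hal : ∀ n : ℤ, n < 0 → a n = 0) (ha : ∀ n : ℤ, ‖a n‖ ≤ 1)
    (hb0 : b 0 = 1) (hbl : ∀ n : ℤ, 0 < n → b n = 0) (hb : ∀ n : ℤ, n < 0 → ‖b n‖ < 1)
    (hbt : Tendsto (fun n : ℤ => ‖b n‖) atBot (𝓝 0))
    (h : (fun m : ℤ => if m = k then (1 : C) else 0) =
      lconv (lconv (fun m => if m = d then c else 0) a) b) : d = k := by
  have hab : ∀ n, ‖b n‖ ≤ 1 := by
    intro n
    rcases lt_trichotomy n 0 with h | h | h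
    · exact (hb n h).le
    · simp [h, hb0]
    · simp [hbl n h]
  have hAc : IsLaurentCoeff a := by
    refine ⟨⟨1, ha⟩, tendsto_const_nhds.congr' ?_⟩
    filter_upwards [Filter.eventually_lt_atBot 0] with n hn
    simp [hal n hn]
  have hBc : IsLaurentCoeff b := ⟨⟨1, hab⟩, hbt⟩
  rw [lconv_assoc (isLaurentCoeff_single d c) hAc hBc] at h
  have hd := congrFun h d
  rw [lconv_single_left, sub_self] at hd
  by_contra hne
  rw [if_neg hne] at hd
  have h0 : lconv a b 0 = 0 := by
    rcases mul_eq_zero.1 hd.symm with h | h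
    · exact absurd h hc
    · exact h
  -- split off the `0` term
  have hsum : Summable fun i : ℤ => a i * b (0 - i) := by
    apply summable_of_eps
    intro ε hε
    obtain ⟨K, hK⟩ := lc_small hBc hε
    refine ⟨Set.Icc 0 (-K), Set.finite_Icc _ _, fun i hi => ?_⟩
    rw [norm_mul]
    by_cases hi0 : i < 0
    · simpa [hal i hi0] using hε
    · have : -K < i := by
        by_contra hh
        exact hi ⟨by lia, by lia⟩
      calc ‖a i‖ * ‖b (0 - i)‖ ≤ 1 * ‖b (0 - i)‖ := by gcongr; exact ha i
        _ < ε := by rw [one_mul]; exact hK _ (by lia)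
  have hsplit : lconv a b 0 = 1 + ∑' i : ℤ, if i = 0 then 0 else a i * b (0 - i) := by
    unfold lconv
    rw [hsum.tsum_eq_add_tsum_ite 0]
    simp [ha0, hb0]
  -- a uniform bound `< 1`
  obtain ⟨K, hK⟩ := lc_small hBc (ε := 1 / 2) (by norm_num)
  obtain ⟨ρ, hρ1, hρ⟩ : ∃ ρ : ℝ, ρ < 1 ∧ ∀ n : ℤ, n < 0 → ‖b n‖ ≤ ρ := by
    have hfin : (Set.Ico K 0).Finite := Set.finite_Ico _ _
    obtain hem | hnem := (Set.Ico K 0).eq_empty_or_nonempty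
    · refine ⟨1 / 2, by norm_num, fun n hn => ?_⟩
      by_cases hnK : n ≤ K
      · exact (hK n hnK).le
      · have : n ∈ Set.Ico K 0 := ⟨by lia, hn⟩
        simp [hem] at this
    · obtain ⟨m, hm, hmax⟩ := Set.exists_max_image _ (fun n => ‖b n‖) hfin hnem
      refine ⟨max (1 / 2) ‖b m‖, max_lt (by norm_num) (hb m hm.2), fun n hn => ?_⟩
      by_cases hnK : n ≤ K
      · exact (hK n hnK).le.trans (le_max_left _ _)
      · exact (hmax n ⟨by lia, hn⟩).trans (le_max_right _ _)
  have hρ0 : 0 ≤ ρ := (norm_nonneg _).trans (hρ (-1) (by norm_num))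
  have hle : ‖∑' i : ℤ, if i = 0 then 0 else a i * b (0 - i)‖ ≤ ρ := by
    apply IsUltrametricDist.norm_tsum_le_of_forall_le
    intro i
    rcases lt_trichotomy i 0 with h | h | h
    · simpa [hal i h] using hρ0
    · simpa [h] using hρ0
    · rw [if_neg h.ne', norm_mul]
      calc ‖a i‖ * ‖b (0 - i)‖ ≤ 1 * ρ :=
            mul_le_mul (ha i) (hρ _ (by lia)) (norm_nonneg _) zero_le_one
        _ = ρ := one_mul _
  rw [h0] at hsplit
  have : ‖∑' i : ℤ, if i = 0 then 0 else a i * b (0 - i)‖ = 1 := by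
    rw [← neg_eq_of_add_eq_zero_right hsplit.symm]
    simp
  linarith

end Conv

end GhostAux

namespace GhostAux

section Root
variable {C : Type*} [NormedField C] [IsUltrametricDist C]

/-- The unit ball of `C`, as a subring. -/
def OO (C : Type*) [NormedField C] [IsUltrametricDist C] : Subring C where
  carrier := {x | ‖x‖ ≤ 1}
  mul_mem' {x y} hx hy := by
    simp only [Set.mem_ofPred_eq] at *
    rw [norm_mul]
    exact mul_le_one₀ hx (norm_nonneg _) hy
  one_mem' := by simp
  add_mem' {x y} hx hy := by
    simp only [Set.mem_ofPred_eq] at *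
    exact (IsUltrametricDist.norm_add_le_max x y).trans (max_le hx hy)
  zero_mem' := by simp
  neg_mem' {x} hx := by simpa using hx

theorem OO.norm_le (x : OO C) : ‖(x : C)‖ ≤ 1 := x.2

theorem OO.isUnit {x : OO C} (hx : ‖(x : C)‖ = 1) : IsUnit x := by
  have h0 : (x : C) ≠ 0 := by
    intro h
    simp [h] at hx
  refine IsUnit.of_mul_eq_one ⟨(x : C)⁻¹, ?_⟩ ?_
  · change ‖(x : C)⁻¹‖ ≤ 1
    rw [norm_inv, hx, inv_one]
  · exact Subtype.ext (mul_inv_cancel₀ h0)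

theorem OO.dvd_iff {d x : OO C} (hd : (d : C) ≠ 0) : d ∣ x ↔ ‖(x : C)‖ ≤ ‖(d : C)‖ := by
  constructor
  · rintro ⟨y, rfl⟩
    rw [Subring.coe_mul, norm_mul]
    exact mul_le_of_le_one_right (norm_nonneg _) (OO.norm_le y)
  · intro h
    refine ⟨⟨(x : C) / d, ?_⟩, Subtype.ext ?_⟩
    · change ‖(x : C) / d‖ ≤ 1
      rw [norm_div]
      exact div_le_one_of_le₀ h (norm_nonneg _)
    · exact (mul_div_cancel₀ _ hd).symm

theorem C_dvd {R : Type*} [CommRing R] (d : R) (g : PowerSeries R) :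
    PowerSeries.C d ∣ g ↔ ∀ n, d ∣ PowerSeries.coeff n g := by
  constructor
  · rintro ⟨h, rfl⟩ n
    exact ⟨_, PowerSeries.coeff_C_mul _ _ _⟩
  · intro h
    choose y hy using h
    exact ⟨PowerSeries.mk y, PowerSeries.ext fun n => by
      rw [hy, PowerSeries.coeff_C_mul, PowerSeries.coeff_mk]⟩

/-- The coefficient sequence of a power series in `T`. -/
noncomputable def E (f : PowerSeries (OO C)) : ℤ → C :=
  fun n => if 0 ≤ n then ((PowerSeries.coeff n.toNat f : OO C) : C) else 0

theorem E_nat (f : PowerSeries (OO C)) (n : ℕ) : E f (n : ℤ) = ((PowerSeries.coeff n f : OO C) : C) := by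
  simp [E]

theorem E_neg (f : PowerSeries (OO C)) {n : ℤ} (hn : n < 0) : E f n = 0 := by
  simp [E, hn]

theorem E_norm (f : PowerSeries (OO C)) (n : ℤ) : ‖E f n‖ ≤ 1 := by
  unfold E
  split_ifs
  · exact OO.norm_le _
  · simp

theorem E_mul (f g : PowerSeries (OO C)) : lconv (E f) (E g) = E (f * g) := by
  funext n
  by_cases hn : n < 0
  · rw [E_neg _ hn]
    unfold lconv
    rw [← tsum_zero (β := ℤ)]
    refine tsum_congr fun i => ?_
    by_cases hi : i < 0
    · rw [E_neg _ hi, zero_mul]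
    · rw [E_neg g (n := n - i) (by lia), mul_zero]
  · obtain ⟨m, rfl⟩ : ∃ m : ℕ, n = m := ⟨n.toNat, by lia⟩
    rw [E_nat, PowerSeries.coeff_mul]
    unfold lconv
    rw [← (Nat.cast_injective (R := ℤ)).tsum_eq, tsum_eq_sum (s := Finset.range (m + 1))]
    · rw [Finset.Nat.sum_antidiagonal_eq_sum_range_succ_mk]
      push_cast
      refine Finset.sum_congr rfl fun i hi => ?_
      have hi' : i ≤ m := Nat.lt_succ_iff.1 (Finset.mem_range.1 hi)
      rw [← Nat.cast_sub hi', E_nat, E_nat]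
    · intro i hi
      have : m < i := by simpa using hi
      rw [E_neg g (n := (m : ℤ) - i) (by lia), mul_zero]
    · intro i hi
      by_cases hi0 : i < 0
      · exfalso
        apply hi
        simp [E_neg _ hi0]
      · exact ⟨i.toNat, by lia⟩

theorem E_one : E (1 : PowerSeries (OO C)) = lone := by
  funext n
  by_cases hn : n < 0
  · rw [E_neg _ hn]
    simp [lone, hn.ne]
  · obtain ⟨m, rfl⟩ : ∃ m : ℕ, n = m := ⟨n.toNat, by lia⟩
    rw [E_nat, PowerSeries.coeff_one]
    by_cases hm : m = 0 <;> simp [lone, hm]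

theorem E_pow (f : PowerSeries (OO C)) (n : ℕ) : lconvPow (E f) n = E (f ^ n) := by
  induction n with
  | zero => rw [pow_zero, E_one]; rfl
  | succ n ih => rw [pow_succ', ← E_mul, ← ih]; rfl

theorem Em_pow (f : PowerSeries (OO C)) (n : ℕ) :
    lconvPow (fun m => E f (-m)) n = fun m => E (f ^ n) (-m) := by
  induction n with
  | zero =>
    funext m
    rw [pow_zero, E_one]
    simp [lconvPow, lone]
  | succ n ih =>
    rw [pow_succ', ← E_mul, ← lconv_reflect, ← ih]
    rfl

theorem isLaurentCoeff_E (f : PowerSeries (OO C)) : IsLaurentCoeff (E f) := by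
  refine ⟨⟨1, E_norm f⟩, tendsto_const_nhds.congr' ?_⟩
  filter_upwards [Filter.eventually_lt_atBot 0] with n hn
  simp [E_neg f hn]

theorem exists_E (a : ℤ → C) (hal : ∀ n : ℤ, n < 0 → a n = 0) (ha : ∀ n : ℤ, ‖a n‖ ≤ 1) :
    ∃ f : PowerSeries (OO C), E f = a := by
  refine ⟨PowerSeries.mk fun n => ⟨a n, ha n⟩, ?_⟩
  funext n
  by_cases hn : n < 0
  · rw [E_neg _ hn, hal n hn]
  · obtain ⟨m, rfl⟩ : ∃ m : ℕ, n = m := ⟨n.toNat, by lia⟩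
    rw [E_nat, PowerSeries.coeff_mk]

theorem constantCoeff_of_E (f : PowerSeries (OO C)) (h : E f 0 = 1) :
    PowerSeries.constantCoeff f = 1 := by
  have := E_nat f 0
  rw [Nat.cast_zero, h] at this
  rw [← PowerSeries.coeff_zero_eq_constantCoeff_apply]
  exact Subtype.ext this.symm

theorem natCast_isUnit {N : ℕ} (hN : ‖(N : C)‖ = 1) : IsUnit (N : OO C) :=
  OO.isUnit (by simpa using hN)

theorem root_plus {N : ℕ} (hN0 : N ≠ 0) (hN : ‖(N : C)‖ = 1) (a : ℤ → C) (ha0 : a 0 = 1)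
    (hal : ∀ n : ℤ, n < 0 → a n = 0) (ha : ∀ n : ℤ, ‖a n‖ ≤ 1) :
    ∃ r : ℤ → C, IsLaurentCoeff r ∧ lconvPow r N = a := by
  obtain ⟨f, rfl⟩ := exists_E a hal ha
  obtain ⟨r, hr, -⟩ := exists_root hN0 (natCast_isUnit hN) f (constantCoeff_of_E f ha0)
  exact ⟨E r, isLaurentCoeff_E r, by rw [E_pow, hr]⟩

theorem exists_varpi (π : C) (hπ0 : 0 < ‖π‖) (hπ1 : ‖π‖ < 1) (b : ℤ → C)
    (hb : ∀ n : ℤ, n < 0 → ‖b n‖ < 1) (hbc : IsLaurentCoeff b) :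
    ∃ d : C, 0 < ‖d‖ ∧ ‖d‖ < 1 ∧ ∀ n : ℤ, n < 0 → ‖b n‖ ≤ ‖d‖ := by
  obtain ⟨K, hK⟩ := lc_small hbc hπ0
  have hfin : (Set.Ico K 0).Finite := Set.finite_Ico _ _
  obtain hem | hnem := (Set.Ico K 0).eq_empty_or_nonempty
  · refine ⟨π, hπ0, hπ1, fun n hn => ?_⟩
    by_cases hnK : n ≤ K
    · exact (hK n hnK).le
    · have : n ∈ Set.Ico K 0 := ⟨by lia, hn⟩
      simp [hem] at this
  · obtain ⟨m, hm, hmax⟩ := Set.exists_max_image _ (fun n => ‖b n‖) hfin hnem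
    have key : ∀ n : ℤ, n < 0 → ‖b n‖ ≤ max ‖π‖ ‖b m‖ := fun n hn => by
      by_cases hnK : n ≤ K
      · exact (hK n hnK).le.trans (le_max_left _ _)
      · exact (hmax n ⟨by lia, hn⟩).trans (le_max_right _ _)
    rcases le_total ‖π‖ ‖b m‖ with h | h
    · exact ⟨b m, hπ0.trans_le h, hb m hm.2, fun n hn => by simpa [h] using key n hn⟩
    · exact ⟨π, hπ0, hπ1, fun n hn => by simpa [h] using key n hn⟩

theorem root_minus (π : C) (hπ0 : 0 < ‖π‖) (hπ1 : ‖π‖ < 1)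
    {N : ℕ} (hN0 : N ≠ 0) (hN : ‖(N : C)‖ = 1) (b : ℤ → C) (hb0 : b 0 = 1)
    (hbl : ∀ n : ℤ, 0 < n → b n = 0) (hb : ∀ n : ℤ, n < 0 → ‖b n‖ < 1)
    (hbc : IsLaurentCoeff b) :
    ∃ r : ℤ → C, IsLaurentCoeff r ∧ lconvPow r N = b := by
  have hb1 : ∀ n, ‖b n‖ ≤ 1 := by
    intro n
    rcases lt_trichotomy n 0 with h | h | h
    · exact (hb n h).le
    · simp [h, hb0]
    · simp [hbl n h]
  obtain ⟨f, hf⟩ := exists_E (fun n => b (-n)) (fun n hn => hbl _ (by lia)) (fun n => hb1 _)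
  have hfb : (fun n => E f (-n)) = b := by
    funext n
    rw [hf]
    simp
  have hfn : ∀ n : ℕ, ((PowerSeries.coeff n f : OO C) : C) = b (-n) := fun n => by
    rw [← E_nat, hf]
  have hNu := natCast_isUnit (C := C) hN
  have hf0 : PowerSeries.constantCoeff f = 1 := constantCoeff_of_E f (by rw [hf]; simpa using hb0)
  obtain ⟨r, hr, hr1⟩ := exists_root hN0 hNu f hf0
  refine ⟨fun n => E r (-n), ⟨⟨1, fun n => E_norm r _⟩, ?_⟩, by rw [Em_pow, hr, hfb]⟩
  obtain ⟨d, hd0, hd1, hd⟩ := exists_varpi π hπ0 hπ1 b hb hbc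
  have hdne : d ≠ 0 := norm_pos_iff.1 hd0
  let δ : OO C := ⟨d, hd1.le⟩
  have hδ : ∀ j, ((δ ^ j : OO C) : C) ≠ 0 := fun j => by
    rw [Subring.coe_pow]
    exact pow_ne_zero _ hdne
  have hδn : ∀ j, ‖((δ ^ j : OO C) : C)‖ = ‖d‖ ^ j := fun j => by
    rw [Subring.coe_pow, norm_pow]
  have h1 : PowerSeries.C δ ∣ r ^ N - 1 := by
    rw [hr, C_dvd]
    intro n
    rw [OO.dvd_iff hdne, map_sub, PowerSeries.coeff_one]
    by_cases hn : n = 0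
    · subst hn
      rw [PowerSeries.coeff_zero_eq_constantCoeff_apply, hf0]
      simp
    · rw [if_neg hn, sub_zero, hfn]
      exact hd _ (by lia)
  rw [Metric.tendsto_nhds]
  intro ε hε
  obtain ⟨j, hj⟩ := exists_pow_lt_of_lt_one hε hd1
  obtain ⟨K, hK⟩ := lc_small hbc (pow_pos hd0 j)
  obtain ⟨q, hq⟩ := root_polyMod hNu r hr1 δ h1 j ⟨PowerSeries.trunc (-K).toNat f, by
    rw [hr, C_dvd]
    intro n
    rw [map_sub, Polynomial.coeff_coe, PowerSeries.coeff_trunc]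
    split_ifs with hn
    · simp
    · rw [sub_zero, OO.dvd_iff (hδ j), hδn, hfn]
      exact (hK _ (by lia)).le⟩
  filter_upwards [Filter.eventually_lt_atBot (-(q.natDegree : ℤ))] with n hn
  rw [dist_zero_right, norm_norm]
  refine lt_of_le_of_lt ?_ hj
  obtain ⟨m, hm⟩ : ∃ m : ℕ, -n = m := ⟨(-n).toNat, by lia⟩
  rw [hm, E_nat]
  have := (C_dvd _ _).1 hq m
  rw [map_sub, Polynomial.coeff_coe, Polynomial.coeff_eq_zero_of_natDegree_lt (by lia), sub_zero,
    OO.dvd_iff (hδ j), hδn] at this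
  exact this

end Root

theorem norm_prime_eq_one {C : Type*} [NormedField C] [IsUltrametricDist C] {p ℓ : ℕ}
    (hp : p.Prime) (hℓ : ℓ.Prime) (hne : ℓ ≠ p) (hnorm : ‖(p : C)‖ < 1) : ‖(ℓ : C)‖ = 1 := by
  refine le_antisymm (IsUltrametricDist.norm_natCast_le_one C ℓ) ?_
  by_contra hlt
  push Not at hlt
  have hcop : IsCoprime (ℓ : ℤ) (p : ℤ) :=
    Nat.isCoprime_iff_coprime.2 ((Nat.coprime_primes hℓ hp).2 hne)
  obtain ⟨x, y, hxy⟩ := hcop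
  have h1 : (x : C) * ℓ + y * p = 1 := by exact_mod_cast congrArg (Int.cast : ℤ → C) hxy
  have hx : ‖(x : C) * ℓ‖ < 1 := by
    rw [norm_mul]
    exact mul_lt_one_of_nonneg_of_lt_one_right (IsUltrametricDist.norm_intCast_le_one C x)
      (norm_nonneg _) hlt
  have hy : ‖(y : C) * p‖ < 1 := by
    rw [norm_mul]
    exact mul_lt_one_of_nonneg_of_lt_one_right (IsUltrametricDist.norm_intCast_le_one C y)
      (norm_nonneg _) hnorm
  have := IsUltrametricDist.norm_add_le_max ((x : C) * ℓ) (y * p)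
  rw [h1, norm_one] at this
  exact absurd this (not_le.2 (max_lt hx hy))

end GhostAux


theorem ghost_circle_symbols (p ℓ : ℕ) (hp : p.Prime) (hℓ : ℓ.Prime) (hℓp : ℓ ≠ p)
    (C : Type*) [NontriviallyNormedField C] [IsAlgClosed C] [CompleteSpace C]
    [IsUltrametricDist C]
    (hnorm : ‖(p : C)‖ = (p : ℝ)⁻¹)
    (hval : ∀ x : C, x ≠ 0 → ∃ q : ℚ, ‖x‖ = (p : ℝ) ^ (-(q : ℝ)))
    (hval' : ∀ q : ℚ, ∃ x : C, x ≠ 0 ∧ ‖x‖ = (p : ℝ) ^ (-(q : ℝ)))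
    -- `deg : M → ℤ`, a group homomorphism,
    (deg : (ℤ → C) → ℤ)
    (hdeg_hom : ∀ u v : ℤ → C, IsLaurentUnit u → IsLaurentUnit v →
      deg (lconv u v) = deg u + deg v)
    -- sending a unit `u` to the integer `k` appearing in its unique
    -- factorization `u = c·T^(deg u)·u₊·u₋`:
    (hdeg_fact : ∀ u : ℤ → C, IsLaurentUnit u →
      ∃ (c : C) (a b : ℤ → C),
        (c ≠ 0 ∧
         (a 0 = 1 ∧ (∀ n : ℤ, n < 0 → a n = 0) ∧ ∀ n : ℤ, ‖a n‖ ≤ 1) ∧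
         (b 0 = 1 ∧ (∀ n : ℤ, 0 < n → b n = 0) ∧
           (∀ n : ℤ, n < 0 → ‖b n‖ < 1) ∧
           Tendsto (fun n : ℤ => ‖b n‖) atBot (𝓝 0))) ∧
        u = lconv (lconv (fun m => if m = deg u then c else 0) a) b) :
    -- injectivity of the induced map `lim_n M/M^{ℓⁿ} → lim_n ℤ/ℓⁿℤ`:
    (∀ u : ℕ → (ℤ → C), (∀ n, IsLaurentUnit (u n)) →
      (∀ n, ∃ w : ℤ → C, IsLaurentUnit w ∧
        u (n + 1) = lconv (u n) (lconvPow w (ℓ ^ n))) →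
      (∀ n, (ℓ : ℤ) ^ n ∣ deg (u n)) →
      ∀ n, ∃ w : ℤ → C, IsLaurentUnit w ∧ u n = lconvPow w (ℓ ^ n)) ∧
    -- surjectivity of the induced map (`lim_n ℤ/ℓⁿℤ = ℤ_ℓ`):
    (∀ k : ℕ → ℤ, (∀ n, (ℓ : ℤ) ^ n ∣ k (n + 1) - k n) →
      ∃ u : ℕ → (ℤ → C), (∀ n, IsLaurentUnit (u n)) ∧
        (∀ n, ∃ w : ℤ → C, IsLaurentUnit w ∧
          u (n + 1) = lconv (u n) (lconvPow w (ℓ ^ n))) ∧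
        ∀ n, (ℓ : ℤ) ^ n ∣ deg (u n) - k n) := by
  have hp1 : (1 : ℝ) < p := by exact_mod_cast hp.one_lt
  have hpi0 : 0 < ‖(p : C)‖ := by rw [hnorm]; positivity
  have hpi1 : ‖(p : C)‖ < 1 := by rw [hnorm]; exact inv_lt_one_of_one_lt₀ hp1
  have hℓ1 := GhostAux.norm_prime_eq_one hp hℓ hℓp hpi1
  refine ⟨fun u hu _ hdvd n => ?_, fun k hk => ?_⟩
  · obtain ⟨c, a, b, ⟨hc, ⟨ha0, hal, ha⟩, hb0, hbl, hb, hbt⟩, hfact⟩ := hdeg_fact (u n) (hu n)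
    have hN0 : ℓ ^ n ≠ 0 := pow_ne_zero _ hℓ.ne_zero
    have hN : ‖((ℓ ^ n : ℕ) : C)‖ = 1 := by
      rw [Nat.cast_pow, norm_pow, hℓ1, one_pow]
    have hbc : IsLaurentCoeff b := by
      refine ⟨⟨1, fun n => ?_⟩, hbt⟩
      rcases lt_trichotomy n 0 with h | h | h
      · exact (hb n h).le
      · simp [h, hb0]
      · simp [hbl n h]
    obtain ⟨r, hrc, hr⟩ := GhostAux.root_plus hN0 hN a ha0 hal ha
    obtain ⟨s, hsc, hs⟩ := GhostAux.root_minus (p : C) hpi0 hpi1 hN0 hN b hb0 hbl hb hbc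
    obtain ⟨e, he⟩ := IsAlgClosed.exists_pow_nat_eq c (Nat.pos_of_ne_zero hN0)
    obtain ⟨m, hm⟩ := hdvd n
    let w : GhostAux.Lau C := GhostAux.Lau.mono m e * ⟨r, hrc⟩ * ⟨s, hsc⟩
    have hw : (w ^ (ℓ ^ n)).1 = u n := by
      simp only [w]
      rw [hfact, mul_pow, mul_pow, GhostAux.Lau.mono_pow, GhostAux.Lau.val_mul,
        GhostAux.Lau.val_mul, GhostAux.Lau.val_pow, GhostAux.Lau.val_pow, hr, hs, he, hm]
      simp [GhostAux.Lau.mono]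
    refine ⟨w.1, ?_, ?_⟩
    · rw [← GhostAux.Lau.isUnit_iff, ← isUnit_pow_iff hN0, GhostAux.Lau.isUnit_iff, hw]
      exact hu n
    · rw [← hw, GhostAux.Lau.val_pow]
  · choose m hm using hk
    refine ⟨fun n => (GhostAux.Lau.mono (k n) (1 : C)).1,
      fun n => (GhostAux.Lau.isUnit_iff _).1 (GhostAux.Lau.isUnit_mono _), fun n =>
      ⟨(GhostAux.Lau.mono (m n) (1 : C)).1,
        (GhostAux.Lau.isUnit_iff _).1 (GhostAux.Lau.isUnit_mono _), ?_⟩, fun n => ?_⟩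
    · rw [← GhostAux.Lau.val_pow, ← GhostAux.Lau.val_mul, GhostAux.Lau.mono_pow,
        GhostAux.Lau.mono_mul]
      have h1 : k (n + 1) = k n + ((ℓ ^ n : ℕ) : ℤ) * m n := by
        have := hm n
        push_cast
        linarith
      beta_reduce
      rw [h1, one_pow, mul_one]
    · obtain ⟨c, a, b, ⟨hc, ⟨ha0, hal, ha⟩, hb0, hbl, hb, hbt⟩, hfact⟩ :=
        hdeg_fact _ ((GhostAux.Lau.isUnit_iff _).1 (GhostAux.Lau.isUnit_mono (C := C) (k n)))
      have := GhostAux.deg_unique (k n) _ c hc a b ha0 hal ha hb0 hbl hb hbt hfact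
      rw [this, sub_self]
      exact dvd_zero _
end
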